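/- Let α > 0 and T > 0. Let u, a : [0,T] → ℝ be integrable and nonnegative with a nondecreasing, let δ ≥ 0 be a constant, and let g : [0,T] → ℝ be continuous, nonnegative and nondecreasing. If u(t) ≤ a(t) + δ u(t) + g(t) ∫_0^t (t − s)^{α−1} u(s) ds for all t ∈ [0,T], then u(t) ≤ ( a(t) + δ u(t) ) · E_α( g(t) Γ(α) t^α ) for all t ∈ [0,T]. -/

import Mathlib

open MeasureTheory

/-- The Mittag-Leffler function `E_α(z) = ∑_{k=0}^∞ z^k / Γ(αk + 1)`. -/
noncomputable def mittagLeffler (α z : ℝ) : ℝ :=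
  ∑' k : ℕ, z ^ k / Real.Gamma (α * k + 1)

open Set ProbabilityTheory
open scoped ENNReal

lemma rpow_mul_exp_neg_le_Gamma_add_one {R x : ℝ} (hR : 0 ≤ R) (hx : 0 ≤ x) :
    R ^ x * Real.exp (-R) ≤ Real.Gamma (x + 1) := by
  have hint := Real.GammaIntegral_convergent (s := x + 1) (by linarith)
  simp only [add_sub_cancel_right] at hint
  have hsub : Ioi R ⊆ Ioi 0 := Ioi_subset_Ioi hR
  rw [Real.Gamma_eq_integral (by linarith), ← integral_exp_neg_Ioi, ← integral_const_mul]
  simp only [add_sub_cancel_right]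
  calc ∫ y in Ioi R, R ^ x * Real.exp (-y)
      ≤ ∫ y in Ioi R, Real.exp (-y) * y ^ x := by
        refine setIntegral_mono_on ?_ (hint.mono_set hsub) measurableSet_Ioi fun y hy => ?_
        · exact (integrableOn_exp_neg_Ioi R).const_mul _
        · rw [mul_comm]
          gcongr
          exact le_of_lt hy
    _ ≤ ∫ y in Ioi 0, Real.exp (-y) * y ^ x := by
        refine setIntegral_mono_set hint ?_ hsub.eventuallyLE
        filter_upwards [ae_restrict_mem measurableSet_Ioi] with y hy
        have : (0 : ℝ) < y := hy
        simp only [Pi.zero_apply]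
        positivity

lemma Gamma_add_one_mul_Gamma_add_one_le {x y : ℝ} (hx : 0 ≤ x) (hy : 0 ≤ y) :
    Real.Gamma (x + 1) * Real.Gamma (y + 1) ≤ Real.Gamma (x + y + 1) := by
  have superadd : ∀ {x y : ℝ}, 0 ≤ x → 0 ≤ y → 0 < x + y →
      Real.log (Real.Gamma (x + 1)) ≤ x / (x + y) * Real.log (Real.Gamma (x + y + 1)) := by
    intro x y hx hy hxy
    have h := Real.convexOn_log_Gamma.2 (mem_Ioi.2 (by linarith : 0 < x + y + 1))
      (mem_Ioi.2 one_pos) (by positivity : 0 ≤ x / (x + y)) (by positivity : 0 ≤ y / (x + y))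
      (by field_simp)
    have e : (x / (x + y)) • (x + y + 1) + (y / (x + y)) • (1 : ℝ) = x + 1 := by
      simp only [smul_eq_mul]
      field_simp
      ring
    rw [e] at h
    simpa using h
  rcases (add_nonneg hx hy).eq_or_lt with h0 | hpos
  · obtain rfl : x = 0 := by linarith
    obtain rfl : y = 0 := by linarith
    simp
  · have hGx := Real.Gamma_pos_of_pos (s := x + 1) (by linarith)
    have hGy := Real.Gamma_pos_of_pos (s := y + 1) (by linarith)
    have hGxy := Real.Gamma_pos_of_pos (s := x + y + 1) (by linarith)
    rw [← Real.log_le_log_iff (by positivity) hGxy, Real.log_mul hGx.ne' hGy.ne']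
    have h1 := superadd hx hy hpos
    have h2 := superadd hy hx (by linarith)
    rw [add_comm y x] at h2
    have h3 : x / (x + y) * Real.log (Real.Gamma (x + y + 1)) +
        y / (x + y) * Real.log (Real.Gamma (x + y + 1)) = Real.log (Real.Gamma (x + y + 1)) := by
      field_simp
    linarith

lemma mittagLeffler_term_nonneg {α z : ℝ} (hα : 0 ≤ α) (hz : 0 ≤ z) (k : ℕ) :
    0 ≤ z ^ k / Real.Gamma (α * k + 1) := by
  have := Real.Gamma_pos_of_pos (s := α * k + 1) (by positivity)
  positivity

lemma summable_mittagLeffler {α z : ℝ} (hα : 0 < α) (hz : 0 ≤ z) :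
    Summable fun k : ℕ => z ^ k / Real.Gamma (α * k + 1) := by
  set R : ℝ := (z + 1) ^ α⁻¹ with hR
  have hR0 : 0 < R := by positivity
  have hRα : R ^ α = z + 1 := by
    rw [hR, ← Real.rpow_mul (by positivity), inv_mul_cancel₀ hα.ne', Real.rpow_one]
  have hgeom : Summable fun k : ℕ => Real.exp R * (z / (z + 1)) ^ k :=
    (summable_geometric_of_lt_one (by positivity)
      ((div_lt_one (by positivity)).2 (by linarith))).mul_left _
  refine hgeom.of_nonneg_of_le (mittagLeffler_term_nonneg hα.le hz) fun k => ?_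
  have h := rpow_mul_exp_neg_le_Gamma_add_one hR0.le (x := α * k) (by positivity)
  rw [Real.rpow_mul hR0.le, hRα, Real.rpow_natCast] at h
  calc z ^ k / Real.Gamma (α * k + 1) ≤ z ^ k / ((z + 1) ^ k * Real.exp (-R)) := by gcongr
    _ = Real.exp R * (z / (z + 1)) ^ k := by
      rw [Real.exp_neg, div_pow]
      field_simp

lemma one_le_mittagLeffler {α z : ℝ} (hα : 0 < α) (hz : 0 ≤ z) : 1 ≤ mittagLeffler α z := by
  have h := (summable_mittagLeffler hα hz).le_tsum 0
    fun k _ => mittagLeffler_term_nonneg hα.le hz k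
  simpa [mittagLeffler] using h

lemma mittagLeffler_div_one_sub_le {α z δ : ℝ} (hα : 0 < α) (hz : 0 ≤ z) (hδ : 0 ≤ δ)
    (hδ1 : δ < 1) :
    mittagLeffler α (z / (1 - δ)) ≤ (1 - δ) * mittagLeffler α z +
      δ * (mittagLeffler α z * mittagLeffler α (z / (1 - δ))) := by
  have h1δ : 0 < 1 - δ := by linarith
  set q : ℝ := (1 - δ)⁻¹ with hq
  have hzq : z / (1 - δ) = z * q := div_eq_mul_inv _ _
  rw [hzq]
  have hq0 : 0 < q := by positivity
  have hS := summable_mittagLeffler hα hz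
  have hSq := summable_mittagLeffler hα (z := z * q) (by positivity)
  have hSn := hS.norm
  have hSqn := hSq.norm
  have hprod := tsum_mul_tsum_eq_tsum_sum_antidiagonal_of_summable_norm hSn hSqn
  have hsum := (summable_norm_sum_mul_antidiagonal_of_summable_norm hSn hSqn).of_norm
  unfold mittagLeffler
  rw [hprod, ← tsum_mul_left, ← tsum_mul_left,
    ← (hS.mul_left (1 - δ)).tsum_add (hsum.mul_left δ)]
  refine hSq.tsum_le_tsum (fun n => ?_) ((hS.mul_left (1 - δ)).add (hsum.mul_left δ))
  have hGn := Real.Gamma_pos_of_pos (s := α * n + 1) (by positivity)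
  have hgeom : q ^ n = (1 - δ) + δ * ∑ p ∈ Finset.HasAntidiagonal.antidiagonal n, q ^ p.2 := by
    have hreflect := Finset.sum_range_reflect (fun j => q ^ j) (n + 1)
    rw [Nat.add_sub_cancel] at hreflect
    rw [Finset.Nat.sum_antidiagonal_eq_sum_range_succ (fun _ j => q ^ j), hreflect]
    clear hGn hreflect
    induction n with
    | zero => simp
    | succ n ih =>
      rw [Finset.sum_range_succ, mul_add, ← add_assoc, ← ih, pow_succ]
      have : q * (1 - δ) = 1 := inv_mul_cancel₀ h1δ.ne'
      linear_combination q ^ n * this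
  calc (z * q) ^ n / Real.Gamma (α * n + 1)
      = (1 - δ) * (z ^ n / Real.Gamma (α * n + 1)) +
        δ * ∑ p ∈ Finset.HasAntidiagonal.antidiagonal n, z ^ n * q ^ p.2 / Real.Gamma (α * n + 1) := by
        rw [← Finset.sum_div, ← Finset.mul_sum, mul_pow, hgeom]
        ring
    _ ≤ _ := by
        gcongr with p hp
        have hp' : p.1 + p.2 = n := Finset.HasAntidiagonal.mem_antidiagonal.1 hp
        have h1 := Real.Gamma_pos_of_pos (s := α * p.1 + 1) (by positivity)
        have h2 := Real.Gamma_pos_of_pos (s := α * p.2 + 1) (by positivity)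
        have h := Gamma_add_one_mul_Gamma_add_one_le (x := α * p.1) (y := α * p.2)
          (by positivity) (by positivity)
        have e : α * p.1 + α * p.2 + 1 = α * n + 1 := by
          rw [← hp']
          push_cast
          ring
        rw [e] at h
        rw [div_mul_div_comm, mul_pow, ← mul_assoc, ← pow_add, hp']
        gcongr

/-- The Riemann–Liouville kernel `x₊ ^ (c - 1)`, without its normalisation by `Γ(c)`. -/
noncomputable def powKernel (c x : ℝ) : ℝ≥0∞ :=
  ENNReal.ofReal (if 0 < x then x ^ (c - 1) else 0)

lemma powKernel_of_pos {c x : ℝ} (hx : 0 < x) :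
    powKernel c x = ENNReal.ofReal (x ^ (c - 1)) := by
  simp [powKernel, hx]

lemma powKernel_of_nonpos {c x : ℝ} (hx : x ≤ 0) : powKernel c x = 0 := by
  simp [powKernel, hx.not_gt]

@[fun_prop]
lemma measurable_powKernel (c : ℝ) : Measurable (powKernel c) :=
  (Measurable.ite measurableSet_Ioi (by fun_prop) (by fun_prop)).ennreal_ofReal

lemma lintegral_powKernel_sub_mul_powKernel {a b : ℝ} (ha : 0 < a) (hb : 0 < b) (x : ℝ) :
    ∫⁻ r, powKernel a (x - r) * powKernel b r =
      ENNReal.ofReal (beta a b) * powKernel (a + b) x := by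
  rcases le_or_gt x 0 with hx | hx
  · rw [powKernel_of_nonpos hx, mul_zero]
    refine (lintegral_congr fun r => ?_).trans lintegral_zero
    rcases le_or_gt r 0 with hr | hr
    · rw [powKernel_of_nonpos hr, mul_zero]
    · rw [powKernel_of_nonpos (by linarith), zero_mul]
  · have hB := beta_pos ha hb
    have hBcomm : beta b a = beta a b := by
      rw [beta, beta, mul_comm, add_comm]
    have key : ∀ r, powKernel a (x - r) * powKernel b r =
        ENNReal.ofReal (beta a b * x ^ (a + b - 2)) * betaPDF b a (x⁻¹ * r) := by
      intro r
      rcases le_or_gt r 0 with hr | hr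
      · rw [powKernel_of_nonpos hr, betaPDF_eq_zero_of_nonpos, mul_zero, mul_zero]
        exact mul_nonpos_of_nonneg_of_nonpos (by positivity) hr
      rcases le_or_gt x r with hxr | hxr
      · rw [powKernel_of_nonpos (by linarith), betaPDF_eq_zero_of_one_le, mul_zero, zero_mul]
        rwa [← div_eq_inv_mul, one_le_div hx]
      · have hxr' : 0 < x - r := by linarith
        rw [powKernel_of_pos hr, powKernel_of_pos hxr', betaPDF_of_pos_lt_one (by positivity)
          (by rwa [← div_eq_inv_mul, div_lt_one hx]), ← ENNReal.ofReal_mul (by positivity),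
          ← ENNReal.ofReal_mul (by positivity), hBcomm]
        congr 1
        have e : 1 - x⁻¹ * r = x⁻¹ * (x - r) := by field_simp
        rw [e, Real.mul_rpow (by positivity) hr.le, Real.mul_rpow (by positivity) hxr'.le,
          Real.inv_rpow hx.le, Real.inv_rpow hx.le,
          show a + b - 2 = (a - 1) + (b - 1) by ring, Real.rpow_add hx]
        have := Real.rpow_pos_of_pos hx (a - 1)
        have := Real.rpow_pos_of_pos hx (b - 1)
        field_simp
    simp_rw [key]
    rw [lintegral_const_mul' _ _ ENNReal.ofReal_ne_top]
    have hscale : ∫⁻ r, betaPDF b a (x⁻¹ * r) = ENNReal.ofReal x := by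
      have hm : Measurable (betaPDF b a) := (measurable_betaPDFReal b a).ennreal_ofReal
      rw [← lintegral_map (f := betaPDF b a) hm (measurable_const_mul x⁻¹),
        Real.map_volume_mul_left (by positivity), lintegral_smul_measure,
        lintegral_betaPDF_eq_one hb ha]
      simp [abs_of_pos hx]
    rw [hscale, powKernel_of_pos hx, ← ENNReal.ofReal_mul (by positivity),
      ← ENNReal.ofReal_mul hB.le, mul_assoc, ← Real.rpow_add_one hx.ne']
    congr 3
    ring

lemma lintegral_exp_neg_mul_powKernel_le {c l : ℝ} (hc : 0 < c) (hl : 0 < l) :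
    ∫⁻ x, ENNReal.ofReal (Real.exp (-(l * x))) * powKernel c x ≤
      ENNReal.ofReal (Real.Gamma c / l ^ c) := by
  have hG := Real.Gamma_pos_of_pos hc
  calc ∫⁻ x, ENNReal.ofReal (Real.exp (-(l * x))) * powKernel c x
      ≤ ∫⁻ x, ENNReal.ofReal (Real.Gamma c / l ^ c) * gammaPDF c l x := by
        refine lintegral_mono fun x => ?_
        rcases le_or_gt x 0 with hx | hx
        · simp [powKernel_of_nonpos hx]
        · rw [powKernel_of_pos hx, gammaPDF_of_nonneg hx.le, ← ENNReal.ofReal_mul (by positivity),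
            ← ENNReal.ofReal_mul (by positivity)]
          refine ENNReal.ofReal_le_ofReal (le_of_eq ?_)
          have := Real.rpow_pos_of_pos hl c
          field_simp
    _ = _ := by
        rw [lintegral_const_mul' _ _ ENNReal.ofReal_ne_top, lintegral_gammaPDF_eq_one hc hl, mul_one]

lemma eq_zero_of_le_lintegral_powKernel {α G : ℝ} (hα : 0 < α) (hG : 0 ≤ G) {F : ℝ → ℝ≥0∞}
    (hFm : AEMeasurable F) (hFi : ∫⁻ x, F x ≠ ∞) (hF0 : ∀ x ≤ 0, F x = 0)
    (hF : ∀ x, F x ≤ ENNReal.ofReal G * ∫⁻ r, powKernel α (x - r) * F r) (x : ℝ) : F x = 0 := by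
  have hΓ := Real.Gamma_pos_of_pos hα
  set l : ℝ := (G * Real.Gamma α + 1) ^ α⁻¹ with hl
  have hl0 : 0 < l := by positivity
  have hlα : l ^ α = G * Real.Gamma α + 1 := by
    rw [hl, ← Real.rpow_mul (by positivity), inv_mul_cancel₀ hα.ne', Real.rpow_one]
  set w : ℝ → ℝ≥0∞ := fun x => ENNReal.ofReal (Real.exp (-(l * x))) with hw
  have hwm : Measurable w := by fun_prop
  have hw_add : ∀ x r, w x = w (x - r) * w r := by
    intro x r
    simp only [hw]
    rw [← ENNReal.ofReal_mul (by positivity), ← Real.exp_add]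
    congr 2
    ring
  set I : ℝ≥0∞ := ∫⁻ x, w x * F x with hI
  have hIfin : I ≠ ∞ := by
    refine ne_top_of_le_ne_top hFi (lintegral_mono fun x => ?_)
    rcases le_or_gt x 0 with hx | hx
    · simp [hF0 x hx]
    · refine mul_le_of_le_one_left zero_le ?_
      rw [hw, ENNReal.ofReal_le_one, Real.exp_le_one_iff]
      have : 0 < l * x := by positivity
      linarith
  have hconv : ∫⁻ x, w x * ∫⁻ r, powKernel α (x - r) * F r ≤
      ENNReal.ofReal (Real.Gamma α / l ^ α) * I := by
    calc ∫⁻ x, w x * ∫⁻ r, powKernel α (x - r) * F r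
        = ∫⁻ x, ∫⁻ r, (w (x - r) * powKernel α (x - r)) * (w r * F r) := by
          refine lintegral_congr fun x => ?_
          rw [← lintegral_const_mul' _ _ ENNReal.ofReal_ne_top]
          refine lintegral_congr fun r => ?_
          change w x * _ = _
          rw [hw_add x r]
          ring
      _ = ∫⁻ r, ∫⁻ x, (w (x - r) * powKernel α (x - r)) * (w r * F r) := by
          refine lintegral_lintegral_swap (AEMeasurable.mul ?_ ?_)
          · exact Measurable.aemeasurable (by fun_prop)
          · exact (hwm.aemeasurable.mul hFm).comp_snd
      _ = ∫⁻ r, (∫⁻ x, w x * powKernel α x) * (w r * F r) := by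
          refine lintegral_congr fun r => ?_
          rw [lintegral_mul_const _ (by fun_prop),
            lintegral_sub_right_eq_self (fun y => w y * powKernel α y) r]
      _ ≤ ∫⁻ r, ENNReal.ofReal (Real.Gamma α / l ^ α) * (w r * F r) := by
          gcongr
          exact lintegral_exp_neg_mul_powKernel_le hα hl0
      _ = _ := lintegral_const_mul' _ _ ENNReal.ofReal_ne_top
  have hII : I ≤ ENNReal.ofReal (G * Real.Gamma α / l ^ α) * I := by
    calc I ≤ ∫⁻ x, ENNReal.ofReal G * (w x * ∫⁻ r, powKernel α (x - r) * F r) := by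
          refine lintegral_mono fun x => ?_
          rw [mul_left_comm]
          gcongr
          exact hF x
      _ = ENNReal.ofReal G * ∫⁻ x, w x * ∫⁻ r, powKernel α (x - r) * F r :=
          lintegral_const_mul' _ _ ENNReal.ofReal_ne_top
      _ ≤ ENNReal.ofReal G * (ENNReal.ofReal (Real.Gamma α / l ^ α) * I) := by gcongr
      _ = _ := by rw [← mul_assoc, ← ENNReal.ofReal_mul hG, mul_div_assoc]
  have hI0 : I = 0 := by
    by_contra hne
    have hlt : ENNReal.ofReal (G * Real.Gamma α / l ^ α) * I < 1 * I := by
      refine ENNReal.mul_lt_mul_left hne hIfin ?_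
      rw [ENNReal.ofReal_lt_one, hlα, div_lt_one (by positivity)]
      linarith
    rw [one_mul] at hlt
    exact hII.not_gt hlt
  have hae : F =ᵐ[volume] 0 := by
    filter_upwards [(lintegral_eq_zero_iff' (hwm.aemeasurable.mul hFm)).1 hI0] with y hy
    have hwy : w y ≠ 0 := by simp [hw, Real.exp_pos]
    exact (mul_eq_zero.1 hy).resolve_left hwy
  have hzero : ∫⁻ r, powKernel α (x - r) * F r = 0 := by
    rw [lintegral_congr_ae (g := fun _ => 0), lintegral_zero]
    filter_upwards [hae] with r hr
    simp [hr]
  simpa [hzero] using hF x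

/-- The Mittag-Leffler solution of `V = A + G ∫ (x - r)₊ ^ (α - 1) V(r) dr` on `(0, ∞)`. -/
noncomputable def mittagLefflerSolution (α A G x : ℝ) : ℝ≥0∞ :=
  ∑' k : ℕ, ENNReal.ofReal (A * ((G * Real.Gamma α) ^ k / Real.Gamma (α * k + 1))) *
    powKernel (α * k + 1) x

@[fun_prop]
lemma measurable_mittagLefflerSolution (α A G : ℝ) : Measurable (mittagLefflerSolution α A G) :=
  Measurable.tsum fun _ => by fun_prop

lemma mittagLefflerSolution_eq {α A G x : ℝ} (hα : 0 < α) (hA : 0 ≤ A) (hG : 0 ≤ G)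
    (hx : 0 < x) :
    mittagLefflerSolution α A G x =
      ENNReal.ofReal A + ENNReal.ofReal G *
        ∫⁻ r, powKernel α (x - r) * mittagLefflerSolution α A G r := by
  have hΓ := Real.Gamma_pos_of_pos hα
  have hconv : ∫⁻ r, powKernel α (x - r) * mittagLefflerSolution α A G r =
      ∑' k : ℕ, ENNReal.ofReal (A * ((G * Real.Gamma α) ^ k / Real.Gamma (α * k + 1))) *
        (ENNReal.ofReal (beta α (α * k + 1)) * powKernel (α + (α * k + 1)) x) := by
    simp_rw [mittagLefflerSolution, ← ENNReal.tsum_mul_left]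
    rw [lintegral_tsum fun k => Measurable.aemeasurable (by fun_prop)]
    refine tsum_congr fun k => ?_
    rw [← lintegral_powKernel_sub_mul_powKernel hα (by positivity),
      ← lintegral_const_mul' _ _ ENNReal.ofReal_ne_top]
    exact lintegral_congr fun r => mul_left_comm _ _ _
  rw [hconv, mittagLefflerSolution, tsum_eq_zero_add' ENNReal.summable, ← ENNReal.tsum_mul_left]
  congr 1
  · simp [powKernel_of_pos hx]
  · refine tsum_congr fun k => ?_
    have hk := Real.Gamma_pos_of_pos (s := α * k + 1) (by positivity)
    have hk' := Real.Gamma_pos_of_pos (s := α + (α * k + 1)) (by positivity)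
    have e : α * ((k + 1 : ℕ) : ℝ) + 1 = α + (α * k + 1) := by
      push_cast
      ring
    rw [e, ← mul_assoc, ← mul_assoc, ← ENNReal.ofReal_mul hG, ← ENNReal.ofReal_mul (by positivity)]
    congr 2
    rw [beta, pow_succ]
    field_simp

lemma mittagLefflerSolution_eq_ofReal {α A G x : ℝ} (hα : 0 < α) (hA : 0 ≤ A) (hG : 0 ≤ G)
    (hx : 0 < x) :
    mittagLefflerSolution α A G x =
      ENNReal.ofReal (A * mittagLeffler α (G * Real.Gamma α * x ^ α)) := by
  have hΓ := Real.Gamma_pos_of_pos hα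
  have hz : 0 ≤ G * Real.Gamma α * x ^ α := by positivity
  rw [mittagLeffler, ← tsum_mul_left, ENNReal.ofReal_tsum_of_nonneg
    (fun k => mul_nonneg hA (mittagLeffler_term_nonneg hα.le hz k))
    ((summable_mittagLeffler hα hz).mul_left A), mittagLefflerSolution]
  refine tsum_congr fun k => ?_
  have hk := Real.Gamma_pos_of_pos (s := α * k + 1) (by positivity)
  rw [powKernel_of_pos hx, ← ENNReal.ofReal_mul (by positivity), add_sub_cancel_right,
    Real.rpow_mul hx.le, Real.rpow_natCast, mul_pow _ (x ^ α)]
  congr 1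
  ring

lemma le_mittagLefflerSolution {α A G t : ℝ} (hα : 0 < α) (hA : 0 ≤ A) (hG : 0 ≤ G)
    {U : ℝ → ℝ≥0∞} (hUm : AEMeasurable U) (hUi : ∫⁻ x, U x ≠ ∞) (hU0 : ∀ x ∉ Ioc 0 t, U x = 0)
    (hU : ∀ x ∈ Ioc 0 t,
      U x ≤ ENNReal.ofReal A + ENNReal.ofReal G * ∫⁻ r, powKernel α (x - r) * U r) (x : ℝ) :
    U x ≤ mittagLefflerSolution α A G x := by
  set V := mittagLefflerSolution α A G with hV
  have hVm : Measurable V := measurable_mittagLefflerSolution α A G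
  refine tsub_eq_zero_iff_le.1 (eq_zero_of_le_lintegral_powKernel (F := fun y => U y - V y)
    hα hG (hUm.sub hVm.aemeasurable)
    (ne_top_of_le_ne_top hUi (lintegral_mono fun y => tsub_le_self)) (fun y hy => ?_)
    (fun y => ?_) x)
  · simp [hU0 y fun h => hy.not_gt h.1]
  · by_cases hy : y ∈ Ioc 0 t
    · rw [tsub_le_iff_left]
      calc U y ≤ ENNReal.ofReal A + ENNReal.ofReal G * ∫⁻ r, powKernel α (y - r) * U r := hU y hy
        _ ≤ ENNReal.ofReal A + ENNReal.ofReal G *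
            ∫⁻ r, (powKernel α (y - r) * V r + powKernel α (y - r) * (U r - V r)) := by
          gcongr with r
          rw [← mul_add]
          gcongr
          exact le_add_tsub
        _ = _ := by
          rw [lintegral_add_left (by fun_prop), mul_add, ← add_assoc,
            ← mittagLefflerSolution_eq hα hA hG hy.1]
    · simp [hU0 y hy]

/-- Fractional Gronwall inequality with constant coefficients. -/
lemma le_mul_mittagLeffler_of_le {α A G t : ℝ} (hα : 0 < α) (hA : 0 ≤ A) (hG : 0 ≤ G)
    (ht : 0 < t) {u : ℝ → ℝ} (hu_int : IntegrableOn u (Ioc 0 t)) (hu : ∀ s ∈ Ioc 0 t, 0 ≤ u s)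
    (h : ∀ s ∈ Ioc 0 t, u s ≤ A + G * ∫ r in (0 : ℝ)..s, (s - r) ^ (α - 1) * u r) :
    u t ≤ A * mittagLeffler α (G * Real.Gamma α * t ^ α) := by
  have hΓ := Real.Gamma_pos_of_pos hα
  have hz : 0 ≤ G * Real.Gamma α * t ^ α := by positivity
  have hE := one_le_mittagLeffler hα hz
  set U : ℝ → ℝ≥0∞ := (Ioc 0 t).indicator fun s => ENNReal.ofReal (u s) with hUdef
  have hmain := le_mittagLefflerSolution (U := U) (t := t) hα hA hG
    ((aemeasurable_indicator_iff measurableSet_Ioc).2 hu_int.aemeasurable.ennreal_ofReal)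
    (by
      rw [lintegral_indicator measurableSet_Ioc]
      exact hu_int.lintegral_lt_top.ne)
    (fun x hx => indicator_of_notMem hx _)
    (fun s hs => ?_) t
  · have htm : t ∈ Ioc 0 t := ⟨ht, le_rfl⟩
    rw [hUdef, indicator_of_mem htm, mittagLefflerSolution_eq_ofReal hα hA hG ht] at hmain
    exact (ENNReal.ofReal_le_ofReal_iff (by positivity)).1 hmain
  · rw [hUdef, indicator_of_mem hs, ← hUdef]
    calc ENNReal.ofReal (u s)
        ≤ ENNReal.ofReal (A + G * ∫ r in (0 : ℝ)..s, (s - r) ^ (α - 1) * u r) :=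
          ENNReal.ofReal_le_ofReal (h s hs)
      _ ≤ ENNReal.ofReal A +
          ENNReal.ofReal G * ENNReal.ofReal (∫ r in (0 : ℝ)..s, (s - r) ^ (α - 1) * u r) := by
          rw [← ENNReal.ofReal_mul hG]
          exact ENNReal.ofReal_add_le
      _ ≤ _ := by
          gcongr
          rw [intervalIntegral.integral_of_le hs.1.le, integral_Ioc_eq_integral_Ioo]
          calc ENNReal.ofReal (∫ r in Ioo 0 s, (s - r) ^ (α - 1) * u r)
              ≤ ‖∫ r in Ioo 0 s, (s - r) ^ (α - 1) * u r‖ₑ := by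
                rw [← ofReal_norm]
                exact ENNReal.ofReal_le_ofReal (le_abs_self _)
            _ ≤ ∫⁻ r in Ioo 0 s, ‖(s - r) ^ (α - 1) * u r‖ₑ := enorm_integral_le_lintegral_enorm _
            _ = ∫⁻ r in Ioo 0 s, powKernel α (s - r) * U r := by
                refine setLIntegral_congr_fun measurableSet_Ioo fun r hr => ?_
                have hsr : 0 < s - r := sub_pos.2 hr.2
                have hrt : r ∈ Ioc 0 t := ⟨hr.1, hr.2.le.trans hs.2⟩
                have hur := hu r hrt
                simp only [hUdef, indicator_of_mem hrt]
                rw [powKernel_of_pos hsr, ← ENNReal.ofReal_mul (by positivity),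
                  Real.enorm_of_nonneg (by positivity)]
            _ ≤ ∫⁻ r, powKernel α (s - r) * U r := setLIntegral_le_lintegral _ _

/-- Fractional Gronwall inequality on `[0,T]` with an extra `δ u(t)` term:
    the bound `u(t) ≤ (a(t) + δ u(t)) E_α(g(t) Γ(α) t^α)`. -/
theorem fractional_gronwall_with_delta
    (α T : ℝ) (hα : 0 < α) (hT : 0 < T)
    (δ : ℝ) (hδ : 0 ≤ δ)
    (u a g : ℝ → ℝ)
    (hu_int : IntegrableOn u (Set.Icc 0 T))
    (ha_int : IntegrableOn a (Set.Icc 0 T))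
    (hu_nonneg : ∀ t ∈ Set.Icc (0 : ℝ) T, 0 ≤ u t)
    (ha_nonneg : ∀ t ∈ Set.Icc (0 : ℝ) T, 0 ≤ a t)
    (ha_mono : MonotoneOn a (Set.Icc (0 : ℝ) T))
    (hg_cont : ContinuousOn g (Set.Icc 0 T))
    (hg_nonneg : ∀ t ∈ Set.Icc (0 : ℝ) T, 0 ≤ g t)
    (hg_mono : MonotoneOn g (Set.Icc (0 : ℝ) T))
    (hineq : ∀ t ∈ Set.Icc (0 : ℝ) T,
      u t ≤ a t + δ * u t + g t * ∫ s in (0 : ℝ)..t, (t - s) ^ (α - 1) * u s) :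
    ∀ t ∈ Set.Icc (0 : ℝ) T,
      u t ≤ (a t + δ * u t) * mittagLeffler α (g t * Real.Gamma α * t ^ α) := by
  intro t ht
  have hΓ := Real.Gamma_pos_of_pos hα
  have hgt := hg_nonneg t ht
  have hat := ha_nonneg t ht
  have hut := hu_nonneg t ht
  have ht0 : 0 ≤ t := ht.1
  set z : ℝ := g t * Real.Gamma α * t ^ α with hz
  have hz0 : 0 ≤ z := by positivity
  have hE := one_le_mittagLeffler hα hz0
  rcases le_or_gt 1 (δ * mittagLeffler α z) with hδE | hδE
  · nlinarith [mul_nonneg hat (zero_le_one.trans hE), mul_le_mul_of_nonneg_left hδE hut]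
  have hδ1 : δ < 1 := (le_mul_of_one_le_right hδ hE).trans_lt hδE
  have h1δ : 0 < 1 - δ := by linarith
  rcases ht0.eq_or_lt with rfl | htpos
  · have h := hineq 0 ht
    simp only [intervalIntegral.integral_same, mul_zero, add_zero] at h
    exact h.trans (le_mul_of_one_le_right (by positivity) hE)
  have hsub : Set.Ioc 0 t ⊆ Set.Icc 0 T := fun s hs => ⟨hs.1.le, hs.2.trans ht.2⟩
  have hconst : u t ≤ a t / (1 - δ) *
      mittagLeffler α (g t / (1 - δ) * Real.Gamma α * t ^ α) := by
    refine le_mul_mittagLeffler_of_le hα (by positivity) (by positivity) htpos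
      (hu_int.mono_set hsub) (fun s hs => hu_nonneg s (hsub hs)) fun s hs => ?_
    have hI : 0 ≤ ∫ r in (0 : ℝ)..s, (s - r) ^ (α - 1) * u r :=
      intervalIntegral.integral_nonneg hs.1.le fun r hr =>
        mul_nonneg (Real.rpow_nonneg (by linarith [hr.2]) _)
          (hu_nonneg r ⟨hr.1, hr.2.trans (hsub hs).2⟩)
    have h := hineq s (hsub hs)
    have h1 := ha_mono (hsub hs) ht hs.2
    have h2 := mul_le_mul_of_nonneg_right (hg_mono (hsub hs) ht hs.2) hI
    rw [div_mul_eq_mul_div, ← add_div, le_div_iff₀ h1δ]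
    linarith
  have hzδ : g t / (1 - δ) * Real.Gamma α * t ^ α = z / (1 - δ) := by
    rw [hz]
    ring
  rw [hzδ] at hconst
  have hseries := mittagLeffler_div_one_sub_le hα hz0 hδ hδ1
  have hfinal : u t * (1 - δ * mittagLeffler α z) ≤ a t * mittagLeffler α z :=
    calc u t * (1 - δ * mittagLeffler α z)
        ≤ a t / (1 - δ) * mittagLeffler α (z / (1 - δ)) * (1 - δ * mittagLeffler α z) :=
          mul_le_mul_of_nonneg_right hconst (by linarith)
      _ = a t / (1 - δ) * (mittagLeffler α (z / (1 - δ)) * (1 - δ * mittagLeffler α z)) :=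
          mul_assoc _ _ _
      _ ≤ a t / (1 - δ) * ((1 - δ) * mittagLeffler α z) := by
          refine mul_le_mul_of_nonneg_left ?_ (by positivity)
          linarith
      _ = a t * mittagLeffler α z := by field_simp
  linarith
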